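/- (Dodgson/Desnanot–Jacobi identity) For an n×n matrix M over a commutative ring and distinct indices i, j, one has det(M) · det(M^{ij,ij}) = det(M^{i,i}) · det(M^{j,j}) − det(M^{i,j}) · det(M^{j,i}), where M^{I,J} denotes the matrix M with rows in I and columns in J deleted. -/

import Mathlib

open Matrix in
lemma aux_minor {R : Type*} [CommRing R] {n : ℕ}
    (M : Matrix (Fin (n + 1)) (Fin (n + 1)) R) (i : Fin (n + 1)) :
    (M.updateRow i (Pi.single i 1)).det = (M.submatrix i.succAbove i.succAbove).det := by
  rw [← Matrix.adjugate_apply, Matrix.adjugate_fin_succ_eq_det_submatrix]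
  simp [← two_mul]

open Matrix in
lemma aux_det {R : Type*} [CommRing R] {m : Type*} [Fintype m] [DecidableEq m]
    (i j : m) (hij : i ≠ j) (a b : m → R) :
    (((1 : Matrix m m R).updateRow i a).updateRow j b).det = a i * b j - a j * b i := by
  have h : ((1 : Matrix m m R).updateRow i a).updateRow j b =
      1 + (Matrix.of fun (k : m) (t : Fin 2) => ![(1 : Matrix m m R) k i, (1 : Matrix m m R) k j] t) *
        (Matrix.of fun (t : Fin 2) (k : m) =>
          ![a k - (1 : Matrix m m R) i k, b k - (1 : Matrix m m R) j k] t) := by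
    ext k l
    simp only [Matrix.add_apply, Matrix.mul_apply, Fin.sum_univ_two, Matrix.updateRow_apply]
    by_cases h1 : k = j
    · subst h1; simp [Matrix.one_apply, hij.symm]
    · by_cases h2 : k = i
      · subst h2; simp [Matrix.one_apply, hij]
      · simp [Matrix.one_apply, h1, h2]
  rw [h, Matrix.det_one_add_mul_comm, Matrix.det_fin_two]
  simp [Matrix.mul_apply, hij, hij.symm, sub_mul, Finset.sum_sub_distrib]
  simp [Matrix.one_apply, hij, hij.symm]

open Matrix in
lemma aux_mul {R : Type*} [CommRing R] {n : ℕ}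
    (M : Matrix (Fin (n + 2)) (Fin (n + 2)) R) (i j : Fin (n + 2)) (hij : i ≠ j)
    (j' : Fin (n + 1)) (hj' : i.succAbove j' = j) :
    M.det * (M.det *
      (M.submatrix (i.succAbove ∘ j'.succAbove) (i.succAbove ∘ j'.succAbove)).det) =
    M.det * ((M.submatrix i.succAbove i.succAbove).det * (M.submatrix j.succAbove j.succAbove).det -
        (M.submatrix i.succAbove j.succAbove).det * (M.submatrix j.succAbove i.succAbove).det) := by
  have hN := aux_det i j hij (M.adjugate i) (M.adjugate j)
  have hmul : ((1 : Matrix _ _ R).updateRow i (M.adjugate i)).updateRow j (M.adjugate j) * M =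
      (M.updateRow i (M.det • Pi.single i 1)).updateRow j (M.det • Pi.single j 1) := by
    have key : ∀ k l, ∑ x, M.adjugate k x * M x l = M.det * (1 : Matrix _ _ R) k l := by
      intro k l
      rw [← Matrix.mul_apply, Matrix.adjugate_mul]; simp
    ext k l
    simp only [Matrix.mul_apply, Matrix.updateRow_apply]
    by_cases h1 : k = j
    · simp [h1, key, Matrix.one_apply, Pi.single_apply, eq_comm]
    · by_cases h2 : k = i
      · simp [h2, hij, key, Matrix.one_apply, Pi.single_apply, eq_comm]
      · simp [h1, h2, Matrix.one_apply]
  have hsub : (M.updateRow j (Pi.single j 1)).submatrix i.succAbove i.succAbove =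
      (M.submatrix i.succAbove i.succAbove).updateRow j' (Pi.single j' 1) := by
    subst hj'
    ext k l
    simp [Matrix.updateRow_apply, Pi.single_apply]
  have hd := congrArg Matrix.det hmul
  rw [Matrix.det_mul, hN, Matrix.det_updateRow_smul, Matrix.updateRow_comm _ hij,
    Matrix.det_updateRow_smul, aux_minor, hsub, aux_minor, Matrix.submatrix_submatrix] at hd
  rw [← hd]
  simp only [Matrix.adjugate_fin_succ_eq_det_submatrix]
  have e : ∀ k : ℕ, ((-1 : R) ^ k) * (-1) ^ k = 1 := fun k => by
    rw [← mul_pow]; simp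
  have e1 := e i
  have e2 := e j
  simp only [pow_add, e1, e2]
  linear_combination (M.det * (M.submatrix i.succAbove j.succAbove).det *
    (M.submatrix j.succAbove i.succAbove).det) *
      (-(-1 : R) ^ (i : ℕ) * (-1) ^ (i : ℕ) * e2 - e1)

/-- Desnanot–Jacobi (Dodgson) identity:
`det M · det M^{ij,ij} = det M^{i,i} · det M^{j,j} − det M^{i,j} · det M^{j,i}`,
where `M^{I,J}` deletes the rows in `I` and the columns in `J`. -/
theorem stmt5 {R : Type*} [CommRing R] {n : ℕ}
    (M : Matrix (Fin (n + 2)) (Fin (n + 2)) R) (i j : Fin (n + 2)) (hij : i ≠ j)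
    (j' : Fin (n + 1)) (hj' : i.succAbove j' = j) :
    M.det * (M.submatrix (i.succAbove ∘ j'.succAbove) (i.succAbove ∘ j'.succAbove)).det =
      (M.submatrix i.succAbove i.succAbove).det * (M.submatrix j.succAbove j.succAbove).det -
        (M.submatrix i.succAbove j.succAbove).det * (M.submatrix j.succAbove i.succAbove).det := by
  have hX := mul_left_cancel₀ (Matrix.det_mvPolynomialX_ne_zero (Fin (n + 2)) ℤ)
    (aux_mul (Matrix.mvPolynomialX (Fin (n + 2)) (Fin (n + 2)) ℤ) i j hij j' hj')
  let f : MvPolynomial (Fin (n + 2) × Fin (n + 2)) ℤ →+* R :=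
    MvPolynomial.eval₂Hom (Int.castRingHom R) fun p => M p.1 p.2
  have hf : (Matrix.mvPolynomialX (Fin (n + 2)) (Fin (n + 2)) ℤ).map f = M := by
    ext k l
    simp [f, Matrix.mvPolynomialX]
  have h := congrArg f hX
  simp only [map_mul, map_sub, RingHom.map_det, RingHom.mapMatrix_apply,
    ← Matrix.submatrix_map, hf] at h
  exact h
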